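/- Let B be a Rota–Baxter operator on a group G. Then the three sets Im(B∘B̃), Im(B̃∘B) and Im(B) ∩ Im(B̃) coincide. -/

import Mathlib

/-- A Rota–Baxter operator of weight 1 on a group. -/
def IsRotaBaxter {G : Type*} [Group G] (B : G → G) : Prop :=
  ∀ g h : G, B g * B h = B (g * B g * h * (B g)⁻¹)

/-- A splitting Rota–Baxter operator: comes from an exact factorization G = HL. -/
def IsSplitting {G : Type*} [Group G] (B : G → G) : Prop :=
  ∃ H L : Subgroup G, H ⊓ L = ⊥ ∧ (∀ g : G, ∃ h ∈ H, ∃ l ∈ L, g = h * l) ∧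
    (∀ h ∈ H, ∀ l ∈ L, B (h * l) = l⁻¹)

/-- The companion Rota–Baxter operator B̃(g) = g⁻¹ · B(g⁻¹). -/
def tilde {G : Type*} [Group G] (B : G → G) : G → G := fun g => g⁻¹ * B g⁻¹

namespace IsRotaBaxter

variable {G : Type*} [Group G] {B : G → G}

theorem map_one (hB : IsRotaBaxter B) : B 1 = 1 := by
  have h := hB 1 1
  simpa using h

theorem inv_apply (hB : IsRotaBaxter B) (g : G) : (B g)⁻¹ = B ((B g)⁻¹ * g⁻¹ * B g) := by
  rw [inv_eq_iff_mul_eq_one, hB, ← hB.map_one]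
  congr 1
  group

/-- `B` commutes with the map `g ↦ g * B g`. -/
theorem apply_mul_apply (hB : IsRotaBaxter B) (g : G) : B (g * B g) = B g * B (B g) := by
  rw [hB, mul_inv_cancel_right]

theorem range_comp_tilde (hB : IsRotaBaxter B) :
    Set.range (B ∘ tilde B) = Set.range fun g => B g * B (B g) := by
  ext y
  constructor
  · rintro ⟨g, rfl⟩
    exact ⟨g⁻¹, (hB.apply_mul_apply g⁻¹).symm⟩
  · rintro ⟨g, rfl⟩
    exact ⟨g⁻¹, by simp [tilde, hB.apply_mul_apply]⟩

theorem range_tilde_comp (hB : IsRotaBaxter B) :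
    Set.range (tilde B ∘ B) = Set.range fun g => B g * B (B g) := by
  ext y
  constructor
  · rintro ⟨g, rfl⟩
    exact ⟨(B g)⁻¹ * g⁻¹ * B g, by simp only [← hB.inv_apply, tilde, Function.comp_apply]⟩
  · rintro ⟨g, rfl⟩
    refine ⟨(B g)⁻¹ * g⁻¹ * B g, ?_⟩
    simp only [← hB.inv_apply, tilde, Function.comp_apply, inv_inv]

theorem range_inter_range_tilde (hB : IsRotaBaxter B) :
    Set.range B ∩ Set.range (tilde B) = Set.range fun g => B g * B (B g) := by
  ext y
  constructor
  · rintro ⟨⟨a, rfl⟩, b, hb⟩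
    obtain ⟨c, hc⟩ : ∃ c, B c = b⁻¹ := by
      rw [tilde, ← eq_mul_inv_iff_mul_eq, hB.inv_apply, hB] at hb
      exact ⟨_, hb.symm⟩
    exact ⟨c, by simpa only [hc, tilde] using hb⟩
  · rintro ⟨g, rfl⟩
    exact ⟨⟨_, hB.apply_mul_apply g⟩, (B g)⁻¹, by simp [tilde]⟩

end IsRotaBaxter

/-- For any Rota–Baxter operator B on a group G, Im(B∘B̃) = Im(B̃∘B) = Im(B) ∩ Im(B̃). -/
theorem stmt5 {G : Type*} [Group G] (B : G → G) (hB : IsRotaBaxter B) :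
    Set.range (B ∘ tilde B) = Set.range (tilde B ∘ B) ∧
    Set.range (B ∘ tilde B) = Set.range B ∩ Set.range (tilde B) := by
  rw [hB.range_comp_tilde, hB.range_tilde_comp, hB.range_inter_range_tilde]
  exact ⟨rfl, rfl⟩
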